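/- arXiv:1906.00233 — 3 statements merged into one kernel-verified Lean document; each statement's English description precedes it below -/
import Mathlib

section
/- Let η > 0 and consider the implicit twisted gradient descent step for L(x,y) = xy: find (x^{n+1}, y^{n+1}) satisfying x^{n+1} = x^n − η y^{n+1} and y^{n+1} = y^n + η x^{n+1}. This system has the unique solution x^{n+1} = (x^n − η y^n)/(1+η²), y^{n+1} = (y^n + η x^n)/(1+η²), and it satisfies (x^{n+1})² + (y^{n+1})² = ((x^n)² + (y^n)²)/(1+η²). Consequently the iterates converge to the saddle point (0,0) for every η > 0, at a geometric rate (1+η²)^{−1/2} that improves without bound as η grows. -/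
/-- A pair solves the implicit twisted gradient step for `L(x,y) = xy` iff it is given by the
closed form. -/
theorem implicit_twisted_step_iff (η a b u v : ℝ) :
    (u = a - η * v ∧ v = b + η * u) ↔
      u = (a - η * b) / (1 + η ^ 2) ∧ v = (b + η * a) / (1 + η ^ 2) := by
  have h : 1 + η ^ 2 ≠ 0 := by positivity
  constructor
  · rintro ⟨hu, hv⟩
    rw [eq_div_iff h, eq_div_iff h]
    constructor
    · linear_combination hu - η * hv
    · linear_combination hv + η * hu
  · rintro ⟨rfl, rfl⟩
    constructor <;> field_simp <;> ring

/-- Implicit twisted gradient descent for `L(x,y) = xy`: the implicit step has a unique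
solution, given in closed form, which contracts the squared norm by `1/(1+η²)`; hence the
iterates converge to the saddle point `(0,0)` for every `η > 0`. -/
theorem implicit_twisted_gd_xy_converges
    (η : ℝ) (hη : 0 < η) (x y : ℕ → ℝ)
    (hx : ∀ n, x (n + 1) = x n - η * y (n + 1))
    (hy : ∀ n, y (n + 1) = y n + η * x (n + 1)) :
    (∀ a b : ℝ, ∃! p : ℝ × ℝ, p.1 = a - η * p.2 ∧ p.2 = b + η * p.1) ∧
    (∀ n, x (n + 1) = (x n - η * y n) / (1 + η ^ 2) ∧
          y (n + 1) = (y n + η * x n) / (1 + η ^ 2)) ∧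
    (∀ n, x (n + 1) ^ 2 + y (n + 1) ^ 2 = (x n ^ 2 + y n ^ 2) / (1 + η ^ 2)) ∧
    Filter.Tendsto (fun n => (x n, y n)) Filter.atTop (nhds (0, 0)) := by
  have hη0 : 0 < 1 + η ^ 2 := by positivity
  have closed n := (implicit_twisted_step_iff η (x n) (y n) _ _).1 ⟨hx n, hy n⟩
  have contract : ∀ n, x (n + 1) ^ 2 + y (n + 1) ^ 2 = (x n ^ 2 + y n ^ 2) / (1 + η ^ 2) := by
    intro n
    rw [(closed n).1, (closed n).2]
    field_simp
    ring
  refine ⟨fun a b => ?_, closed, contract, ?_⟩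
  · refine ⟨((a - η * b) / (1 + η ^ 2), (b + η * a) / (1 + η ^ 2)),
      (implicit_twisted_step_iff η a b _ _).2 ⟨rfl, rfl⟩, fun p hp => ?_⟩
    exact Prod.ext_iff.2 ((implicit_twisted_step_iff η a b p.1 p.2).1 hp)
  · have geom : ∀ n, x n ^ 2 + y n ^ 2 = (x 0 ^ 2 + y 0 ^ 2) * (1 + η ^ 2)⁻¹ ^ n := by
      intro n
      induction n with
      | zero => simp
      | succ n ih => rw [contract, ih, pow_succ (1 + η ^ 2)⁻¹, div_eq_mul_inv, mul_assoc]
    have hlim : Filter.Tendsto (fun n => x n ^ 2 + y n ^ 2) Filter.atTop (nhds 0) := by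
      have hη1 : (1 + η ^ 2)⁻¹ < 1 := inv_lt_one_of_one_lt₀ (by nlinarith)
      rw [funext geom]
      simpa using
        (tendsto_pow_atTop_nhds_zero_of_lt_one (inv_pos.2 hη0).le hη1).const_mul
          (x 0 ^ 2 + y 0 ^ 2)
    have hsqrt : Filter.Tendsto (fun n => √(x n ^ 2 + y n ^ 2)) Filter.atTop (nhds 0) := by
      simpa using hlim.sqrt
    exact (squeeze_zero_norm
      (fun n => Real.abs_le_sqrt (le_add_of_nonneg_right (sq_nonneg (y n)))) hsqrt).prodMk_nhds
      (squeeze_zero_norm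
        (fun n => Real.abs_le_sqrt (le_add_of_nonneg_left (sq_nonneg (x n)))) hsqrt)
end

section
/- Let L(x,y) = (x² + y²)/2, let η > 0 with η ≠ 1, and let (x⁺, y⁺) = (x/(1+η), y/(1−η)) be the implicit twisted gradient descent step from (x,y). Then L(x⁺, y⁺) − L(x⁺, y) = (y²/2)(1/(1−η)² − 1) and L(x⁺, y⁺) − L(x, y⁺) = (x²/2)(1/(1+η)² − 1) ≤ 0. The condition L(x⁺, y⁺) ≥ L(x⁺, y) holds for all (x,y) if and only if η ≤ 2: for η > 2 and y ≠ 0 it fails, while for 0 < η < 2 (η ≠ 1) it holds. Hence the acceptance test restricts the learning rate to η < 2, preventing convergence to the spurious stationary point (0,0). -/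
/-- For `L(x,y) = (x² + y²)/2` and the implicit step `(x⁺, y⁺) = (x/(1+η), y/(1−η))`:
explicit formulas for the acceptance gaps; the condition `L(x⁺,y⁺) ≥ L(x⁺,y)` holds for
all `(x,y)` iff `η ≤ 2`; it fails for `η > 2` when `y ≠ 0`, and holds for `0 < η < 2`.
Hence the acceptance test restricts the learning rate to `η < 2`. -/
theorem acceptance_conditions_x2_plus_y2
    (η : ℝ) (hη : 0 < η) (hη1 : η ≠ 1)
    (L : ℝ → ℝ → ℝ) (hL : L = fun a b => (a ^ 2 + b ^ 2) / 2)
    (xp yp : ℝ → ℝ)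
    (hxp : ∀ x, xp x = x / (1 + η)) (hyp : ∀ y, yp y = y / (1 - η)) :
    (∀ x y : ℝ, L (xp x) (yp y) - L (xp x) y = y ^ 2 / 2 * (1 / (1 - η) ^ 2 - 1)) ∧
    (∀ x y : ℝ, L (xp x) (yp y) - L x (yp y) = x ^ 2 / 2 * (1 / (1 + η) ^ 2 - 1)) ∧
    (∀ x y : ℝ, L (xp x) (yp y) - L x (yp y) ≤ 0) ∧
    ((∀ x y : ℝ, L (xp x) y ≤ L (xp x) (yp y)) ↔ η ≤ 2) ∧
    (2 < η → ∀ x y : ℝ, y ≠ 0 → ¬ (L (xp x) y ≤ L (xp x) (yp y))) ∧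
    (η < 2 → ∀ x y : ℝ, L (xp x) y ≤ L (xp x) (yp y)) := by
  have hm : 1 - η ≠ 0 := sub_ne_zero.mpr hη1.symm
  have hm2 : 0 < (1 - η) ^ 2 := by positivity
  have gap_y : ∀ x y : ℝ,
      L (xp x) (yp y) - L (xp x) y = y ^ 2 / 2 * (1 / (1 - η) ^ 2 - 1) := by
    intro x y
    simp only [hL, hyp, div_pow]
    ring
  have gap_x : ∀ x y : ℝ,
      L (xp x) (yp y) - L x (yp y) = x ^ 2 / 2 * (1 / (1 + η) ^ 2 - 1) := by
    intro x y
    simp only [hL, hxp, div_pow]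
    ring
  have accept : η ≤ 2 → ∀ x y : ℝ, L (xp x) y ≤ L (xp x) (yp y) := by
    intro h x y
    rw [← sub_nonneg, gap_y]
    have : 1 ≤ 1 / (1 - η) ^ 2 := (one_le_div hm2).mpr (by nlinarith)
    exact mul_nonneg (by positivity) (sub_nonneg.mpr this)
  have reject : 2 < η → ∀ x y : ℝ, y ≠ 0 → ¬ (L (xp x) y ≤ L (xp x) (yp y)) := by
    intro h x y hy
    rw [← sub_nonneg, gap_y, not_le]
    have : 1 / (1 - η) ^ 2 < 1 := (div_lt_one hm2).mpr (by nlinarith)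
    exact mul_neg_of_pos_of_neg (by positivity) (sub_neg.mpr this)
  refine ⟨gap_y, gap_x, fun x y => ?_, ⟨fun h => ?_, accept⟩, reject, fun h => accept h.le⟩
  · rw [gap_x]
    have : 1 / (1 + η) ^ 2 ≤ 1 := (div_le_one (by positivity)).mpr (by nlinarith)
    exact mul_nonpos_of_nonneg_of_nonpos (by positivity) (sub_nonpos.mpr this)
  · by_contra! h2
    exact reject h2 0 1 one_ne_zero (h 0 1)
end

section
/- Let L(x,y) = (x² + y²)/2 and fix η with 0 < η < 2 and η ≠ 1. Starting from any (x⁰, y⁰) with y⁰ ≠ 0, the iterates of the implicit twisted gradient descent step (x^{n+1}, y^{n+1}) = (x^n/(1+η), y^n/(1−η)) satisfy |y^n| = |y⁰| / |1−η|^n → ∞ as n → ∞. Hence for every admissible learning rate (η < 2, as imposed by the acceptance conditions) the iterates diverge, as required for a Lagrangian with no min-max saddle point. -/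
/-- For `L(x,y) = (x² + y²)/2` and any admissible learning rate `0 < η < 2`, `η ≠ 1`,
the implicit twisted gradient descent iterates `(x^{n+1}, y^{n+1}) = (xⁿ/(1+η), yⁿ/(1−η))`
starting from `y⁰ ≠ 0` satisfy `|yⁿ| = |y⁰|/|1−η|ⁿ → ∞`: the iterates diverge, as
required for a Lagrangian with no min-max saddle point. -/
theorem implicit_twisted_gd_x2_plus_y2_diverges
    (η : ℝ) (hη0 : 0 < η) (hη2 : η < 2) (hη1 : η ≠ 1)
    (x y : ℕ → ℝ) (hy0 : y 0 ≠ 0)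
    (hx : ∀ n, x (n + 1) = x n / (1 + η))
    (hy : ∀ n, y (n + 1) = y n / (1 - η)) :
    (∀ n, |y n| = |y 0| / |1 - η| ^ n) ∧
    Filter.Tendsto (fun n => |y n|) Filter.atTop Filter.atTop := by
  have hclosed : ∀ n, |y n| = |y 0| / |1 - η| ^ n := by
    intro n
    induction n with
    | zero => simp
    | succ n ih => rw [hy, abs_div, ih, pow_succ, div_div]
  refine ⟨hclosed, ?_⟩
  have hpos : 0 < |1 - η| := abs_pos.mpr (sub_ne_zero.mpr hη1.symm)
  have hlt : |1 - η| < 1 := abs_lt.mpr ⟨by linarith, by linarith⟩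
  rw [funext hclosed]
  simp_rw [div_eq_mul_inv, ← inv_pow]
  exact (tendsto_pow_atTop_atTop_of_one_lt ((one_lt_inv₀ hpos).mpr hlt)).const_mul_atTop
    (abs_pos.mpr hy0)
end
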